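/- There exists an absolute constant C > 0 such that the following holds. Let A ⊆ 𝔽_3^n be nonempty of density α = |A|/3^n with α ≤ 1/2, and let m ≥ 1 be an integer. If ‖μ_A * 1_A‖_{L^{2m}} ≥ 10α, then there exists a linear subspace V ≤ 𝔽_3^n of codimension at most C·(log(1/α))^C·m/α such that A has density at least 5α on some coset of V, i.e., |A ∩ (x + V)|/|V| ≥ 5α for some x ∈ 𝔽_3^n. -/

import Mathlib

open scoped Classical

variable {G : Type*} [AddCommGroup G] [Fintype G]

/-- Average of a function over a finite type. -/
noncomputable def expect (f : G → ℝ) : ℝ := (∑ x, f x) / Fintype.card G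

/-- Normalized convolution `(f * g)(x) = 𝔼_y f(x − y) g(y)`. -/
noncomputable def conv (f g : G → ℝ) : G → ℝ := fun x => expect fun y => f (x - y) * g y

/-- The `L^p` norm `‖f‖_{L^p} = (𝔼_x |f(x)|^p)^{1/p}` (with normalized counting measure). -/
noncomputable def lpNorm (p : ℝ) (f : G → ℝ) : ℝ := (expect fun x => |f x| ^ p) ^ (1 / p)

/-- The indicator function `1_A`. -/
noncomputable def ind (A : Finset G) : G → ℝ := fun x => if x ∈ A then 1 else 0

/-- The normalized indicator `μ_A = 1_A / μ(A)`, of mean 1. -/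
noncomputable def nind (A : Finset G) : G → ℝ :=
  fun x => if x ∈ A then (Fintype.card G : ℝ) / A.card else 0


open scoped BigOperators

lemma conv_nind_ind (A : Finset G) (x : G) :
    conv (nind A) (ind A) x = (∑ a ∈ A, ind A (x - a)) / A.card := by
  have hG : (Fintype.card G : ℝ) ≠ 0 := Nat.cast_ne_zero.2 Fintype.card_ne_zero
  have h : ∀ y, nind A (x - y) * ind A y
      = if y ∈ A then ind A (x - y) * ((Fintype.card G : ℝ) / A.card) else 0 := by
    intro y
    unfold nind ind
    split_ifs <;> simp
  simp only [conv, expect, h]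
  rw [Finset.sum_ite_mem, Finset.univ_inter, ← Finset.sum_mul]
  field_simp

lemma ind_nonneg (A : Finset G) (x : G) : 0 ≤ ind A x := by
  unfold ind; split_ifs <;> norm_num

lemma ind_le_one (A : Finset G) (x : G) : ind A x ≤ 1 := by
  unfold ind; split_ifs <;> norm_num

lemma conv_nind_ind_nonneg (A : Finset G) (x : G) : 0 ≤ conv (nind A) (ind A) x := by
  rw [conv_nind_ind]
  exact div_nonneg (Finset.sum_nonneg fun a _ => ind_nonneg A _) (Nat.cast_nonneg _)

lemma conv_nind_ind_le_one (A : Finset G) (x : G) : conv (nind A) (ind A) x ≤ 1 := by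
  rw [conv_nind_ind]
  refine div_le_one_of_le₀ ?_ (Nat.cast_nonneg _)
  simpa using Finset.sum_le_card_nsmul A (fun a => ind A (x - a)) 1 fun a _ => ind_le_one A _

/-- Bernstein-type bound on the exponential moment of a centred `{0,1}`-valued variable. -/
lemma sum_exp_centered_le {ι : Type*} (A : Finset ι) (f : ι → ℝ) (p l : ℝ)
    (hf : ∀ a, f a = 0 ∨ f a = 1) (hp : ∑ a ∈ A, f a = A.card * p) (hp0 : 0 ≤ p) (hl : |l| ≤ 1) :
    ∑ a ∈ A, Real.exp (l * (f a - p)) ≤ A.card * Real.exp (l ^ 2 * p) := by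
  have h1 : ∀ a, Real.exp (l * (f a - p))
      = Real.exp (-(l * p)) * (1 + (Real.exp l - 1) * f a) := by
    intro a
    rcases hf a with h | h <;> rw [h]
    · simp
    · rw [mul_sub, sub_eq_neg_add, Real.exp_add]; simp
  simp only [h1]
  rw [← Finset.mul_sum, Finset.sum_add_distrib, ← Finset.mul_sum, hp]
  have h2 := (abs_le.1 (Real.abs_exp_sub_one_sub_id_le hl)).2
  have h3 : 1 + (Real.exp l - 1) * p ≤ Real.exp ((l + l ^ 2) * p) := by
    have := Real.add_one_le_exp ((l + l ^ 2) * p)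
    nlinarith
  calc Real.exp (-(l * p)) * (∑ _a ∈ A, (1 : ℝ) + (Real.exp l - 1) * (A.card * p))
      = A.card * (Real.exp (-(l * p)) * (1 + (Real.exp l - 1) * p)) := by simp; ring
    _ ≤ A.card * (Real.exp (-(l * p)) * Real.exp ((l + l ^ 2) * p)) := by gcongr
    _ = A.card * Real.exp (l ^ 2 * p) := by rw [← Real.exp_add]; ring_nf

lemma sum_piFinset_exp_centered_le {ι : Type*} (A : Finset ι) (f : ι → ℝ) (p l : ℝ) (k : ℕ)
    (hf : ∀ a, f a = 0 ∨ f a = 1) (hp : ∑ a ∈ A, f a = A.card * p) (hp0 : 0 ≤ p) (hl : |l| ≤ 1) :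
    ∑ a ∈ Fintype.piFinset fun _ : Fin k => A, Real.exp (l * ∑ i, (f (a i) - p))
      ≤ (A.card : ℝ) ^ k * Real.exp (k * (l ^ 2 * p)) := by
  have h := Finset.prod_univ_sum (fun _ : Fin k => A) fun _ a => Real.exp (l * (f a - p))
  simp only [Finset.mul_sum, Real.exp_sum]
  rw [← h, Finset.prod_const, Finset.card_univ, Fintype.card_fin, Real.exp_nat_mul, ← mul_pow]
  exact pow_le_pow_left₀ (Finset.sum_nonneg fun _ _ => (Real.exp_pos _).le)
    (sum_exp_centered_le A f p l hf hp hp0 hl) k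

lemma even_pow_le_factorial_mul (y : ℝ) (m : ℕ) :
    y ^ (2 * m) ≤ (2 * m).factorial * (Real.exp y + Real.exp (-y)) := by
  have h := Real.pow_div_factorial_le_exp |y| (abs_nonneg y) (2 * m)
  rw [div_le_iff₀ (by positivity), (even_two_mul m).pow_abs] at h
  have h2 : Real.exp |y| ≤ Real.exp y + Real.exp (-y) := by
    rcases abs_choice y with h | h <;> rw [h] <;> linarith [Real.exp_pos y, Real.exp_pos (-y)]
  nlinarith [(Nat.cast_pos (α := ℝ)).2 (2 * m).factorial_pos]

/-- Marcinkiewicz–Zygmund-type moment bound for a sum of `k` independent samples of a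
`{0,1}`-valued function of mean at most `q`. -/
lemma sum_piFinset_pow_le {ι : Type*} (A : Finset ι) (f : ι → ℝ) (p q : ℝ) (k m : ℕ)
    (hf : ∀ a, f a = 0 ∨ f a = 1) (hp : ∑ a ∈ A, f a = A.card * p) (hp0 : 0 ≤ p)
    (hpq : p ≤ q) (hm : 1 ≤ m) (hkq : (m : ℝ) ≤ k * q) :
    ∑ a ∈ Fintype.piFinset fun _ : Fin k => A, (∑ i, (f (a i) - p)) ^ (2 * m)
      ≤ (A.card : ℝ) ^ k * (2 * (12 * m * k * q) ^ m) := by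
  have hm0 : (0 : ℝ) < m := by exact_mod_cast hm
  have hkq0 : 0 < k * q := hm0.trans_le hkq
  set l := Real.sqrt (m / (k * q)) with hl
  have hl2 : l ^ 2 = m / (k * q) := Real.sq_sqrt (by positivity)
  have hl0 : 0 < l := Real.sqrt_pos.2 (by positivity)
  have hl1 : |l| ≤ 1 := by
    rw [abs_of_pos hl0, ← abs_one, ← sq_le_sq₀ (by positivity) (by positivity), hl2]
    simpa using (div_le_one hkq0).2 hkq
  have hexp : Real.exp (k * (l ^ 2 * p)) ≤ Real.exp 1 ^ m := by
    rw [← Real.exp_nat_mul, Real.exp_le_exp, mul_one]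
    calc (k : ℝ) * (l ^ 2 * p) ≤ k * (l ^ 2 * q) := by gcongr
      _ = m / (k * q) * (k * q) := by rw [hl2]; ring
      _ = m := div_mul_cancel₀ _ hkq0.ne'
  have hfac : ((2 * m).factorial : ℝ) ≤ (4 * (m : ℝ) ^ 2) ^ m := by
    have : ((2 * m).factorial : ℝ) ≤ ((2 * m : ℕ) : ℝ) ^ (2 * m) := by
      exact_mod_cast Nat.factorial_le_pow _
    refine this.trans_eq ?_
    rw [pow_mul]; push_cast; ring_nf
  have hterm : ∀ y : ℝ, y ^ (2 * m)
      ≤ (2 * m).factorial * (k * q / m) ^ m * (Real.exp (l * y) + Real.exp (-l * y)) := by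
    intro y
    have h := even_pow_le_factorial_mul (l * y) m
    have h' : y ^ (2 * m) = (k * q / m) ^ m * (l * y) ^ (2 * m) := by
      rw [mul_pow, pow_mul l, hl2, ← mul_assoc, ← mul_pow]
      rw [div_mul_div_cancel₀ hm0.ne', div_self hkq0.ne', one_pow, one_mul]
    rw [h', neg_mul]
    calc _ ≤ (k * q / m) ^ m * _ := mul_le_mul_of_nonneg_left h (by positivity)
      _ = _ := by ring
  have hsum (s : ℝ) (hs : |s| ≤ 1) (hs2 : s ^ 2 = l ^ 2) :
      ∑ a ∈ Fintype.piFinset fun _ : Fin k => A, Real.exp (s * ∑ i, (f (a i) - p))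
        ≤ (A.card : ℝ) ^ k * Real.exp 1 ^ m := by
    refine (sum_piFinset_exp_centered_le A f p s k hf hp hp0 hs).trans ?_
    rw [hs2]; gcongr
  calc _ ≤ ∑ a ∈ Fintype.piFinset fun _ : Fin k => A, (2 * m).factorial * (k * q / m) ^ m *
        (Real.exp (l * ∑ i, (f (a i) - p)) + Real.exp (-l * ∑ i, (f (a i) - p))) :=
        Finset.sum_le_sum fun a _ => hterm _
    _ ≤ (4 * (m : ℝ) ^ 2) ^ m * (k * q / m) ^ m *
        ((A.card : ℝ) ^ k * Real.exp 1 ^ m + (A.card : ℝ) ^ k * Real.exp 1 ^ m) := by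
        rw [← Finset.mul_sum, Finset.sum_add_distrib]
        gcongr
        · exact hsum l hl1 rfl
        · exact hsum (-l) (by rwa [abs_neg]) (neg_sq l)
    _ = (A.card : ℝ) ^ k * (2 * (4 * Real.exp 1 * m * k * q) ^ m) := by
        rw [← two_mul, ← mul_assoc 2, mul_comm 2, mul_assoc ((A.card : ℝ) ^ k), mul_left_comm,
          mul_left_comm _ 2, ← mul_pow, ← mul_pow]
        have : 4 * (m : ℝ) ^ 2 * (k * q / m) * Real.exp 1 = 4 * Real.exp 1 * m * k * q := by
          field_simp
        rw [this]
    _ ≤ _ := by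
        have := Real.exp_one_lt_d9
        have hq0 : 0 ≤ q := hp0.trans hpq
        gcongr
        linarith

/-- Summing the moment bound over all translates: the random sampling error for `μ_A * 1_A` is
small in `L^{2m}` on average. -/
lemma sum_sum_sampling_error_le (A : Finset G) (hA : A.Nonempty) (m k : ℕ) (hm : 1 ≤ m) (K : ℝ)
    (hK : 0 < K) (hnorm : ∑ x, conv (nind A) (ind A) x ^ (2 * m) = Fintype.card G * K ^ (2 * m))
    (hk : (m : ℝ) ≤ k * K) :
    ∑ a ∈ Fintype.piFinset fun _ : Fin k => A,
      ∑ x, (∑ i, (ind A (x - a i) - conv (nind A) (ind A) x)) ^ (2 * m)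
      ≤ (A.card : ℝ) ^ k * (4 * Fintype.card G * (12 * m * k * K) ^ m) := by
  set p := conv (nind A) (ind A) with hp
  have hA0 : (A.card : ℝ) ≠ 0 := Nat.cast_ne_zero.2 hA.card_ne_zero
  have hp0 : ∀ x, 0 ≤ p x := conv_nind_ind_nonneg A
  have hcs : ∑ x, p x ^ m ≤ Fintype.card G * K ^ m := by
    have h := sq_sum_le_card_mul_sum_sq (s := Finset.univ) (f := fun x => p x ^ m)
    simp only [← pow_mul, mul_comm m 2, hnorm, Finset.card_univ] at h
    refine le_of_sq_le_sq ?_ (by positivity)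
    refine h.trans_eq ?_
    ring
  rw [Finset.sum_comm]
  calc _ ≤ ∑ x, (A.card : ℝ) ^ k * (2 * (12 * m * k * max (p x) K) ^ m) := by
        refine Finset.sum_le_sum fun x _ => ?_
        refine sum_piFinset_pow_le A (fun a => ind A (x - a)) (p x) _ k m ?_ ?_ (hp0 x)
          (le_max_left _ _) hm (hk.trans (by gcongr; exact le_max_right _ _))
        · intro a; unfold ind; split_ifs <;> simp
        · rw [hp, conv_nind_ind]; field_simp
    _ ≤ ∑ x, (A.card : ℝ) ^ k * (2 * ((12 * m * k) ^ m * (p x ^ m + K ^ m))) := by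
        refine Finset.sum_le_sum fun x _ => ?_
        rw [mul_pow]
        gcongr
        rcases max_choice (p x) K with h | h <;> rw [h]
        · linarith [pow_pos hK m]
        · linarith [pow_nonneg (hp0 x) m]
    _ ≤ (A.card : ℝ) ^ k * (2 * ((12 * m * k) ^ m *
          (Fintype.card G * K ^ m + Fintype.card G * K ^ m))) := by
        rw [← Finset.mul_sum, ← Finset.mul_sum, ← Finset.mul_sum, Finset.sum_add_distrib]
        gcongr
        simp
    _ = _ := by rw [mul_pow _ K]; ring

/-- Markov's inequality for finite sums, in the form that at least half of the points are good. -/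
lemma card_le_two_mul_card_filter {ι : Type*} (s : Finset ι) (F : ι → ℝ) (B : ℝ) (hB : 0 < B)
    (hF : ∀ a, 0 ≤ F a) (h : ∑ a ∈ s, F a ≤ s.card * B) :
    (s.card : ℝ) ≤ 2 * (s.filter fun a => F a ≤ 2 * B).card := by
  have h1 : ((s.filter fun a => ¬ F a ≤ 2 * B).card : ℝ) * (2 * B) ≤ ∑ a ∈ s, F a := by
    rw [← nsmul_eq_mul]
    refine (Finset.card_nsmul_le_sum _ F _ fun a ha => ?_).trans
      (Finset.sum_le_sum_of_subset_of_nonneg (Finset.filter_subset _ _) fun a _ _ => hF a)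
    exact (not_le.1 (Finset.mem_filter.1 ha).2).le
  have h2 : ((s.filter fun a => F a ≤ 2 * B).card : ℝ)
      + (s.filter fun a => ¬ F a ≤ 2 * B).card = s.card := by
    exact_mod_cast Finset.card_filter_add_card_filter_not (s := s) fun a => F a ≤ 2 * B
  have h3 := h1.trans h
  have h4 : ((s.filter fun a => ¬ F a ≤ 2 * B).card : ℝ) * 2 ≤ s.card :=
    le_of_mul_le_mul_right (by linarith) hB
  linarith

/-- Some tuple has many diagonal translates in a given set of tuples. -/
lemma exists_many_diagonal_translates (k : ℕ) (T : Finset (Fin k → G)) :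
    ∃ b : Fin k → G, (Fintype.card G : ℝ) * T.card
      ≤ (Fintype.card G : ℝ) ^ k * (Finset.univ.filter fun t : G => (fun i => b i - t) ∈ T).card := by
  by_contra! h
  have hfib (t : G) : ∑ b : Fin k → G, (if (fun i => b i - t) ∈ T then (1 : ℝ) else 0) = T.card := by
    have := Equiv.sum_comp (Equiv.subRight (fun _ : Fin k => t))
      (fun b => if b ∈ T then (1 : ℝ) else 0)
    rw [Finset.sum_ite_mem, Finset.univ_inter] at this
    simpa [Pi.sub_def] using this
  have hcount : ∑ b : Fin k → G,
      ((Finset.univ.filter fun t : G => (fun i => b i - t) ∈ T).card : ℝ)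
      = Fintype.card G * T.card := by
    simp only [Finset.card_filter, Nat.cast_sum, Nat.cast_ite, Nat.cast_one, Nat.cast_zero]
    rw [Finset.sum_comm]
    simp only [hfib]
    simp
  have h2 := Finset.sum_lt_sum_of_nonempty (Finset.univ_nonempty (α := Fin k → G))
    fun b _ => h b
  rw [← Finset.mul_sum, hcount] at h2
  simp at h2

/-- The `L^{2m}` norm with respect to counting measure is a seminorm. -/
lemma exists_seminorm_pow_eq_sum (ι : Type*) [Fintype ι] (m : ℕ) (hm : 1 ≤ m) :
    ∃ N : Seminorm ℝ (ι → ℝ), ∀ f, N f ^ (2 * m) = ∑ x, f x ^ (2 * m) := by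
  have : Fact (1 ≤ ((2 * m : ℕ) : ENNReal)) := ⟨by exact_mod_cast (by omega : 1 ≤ 2 * m)⟩
  refine ⟨(normSeminorm ℝ (PiLp ((2 * m : ℕ) : ENNReal) fun _ : ι => ℝ)).comp
    (WithLp.linearEquiv ((2 * m : ℕ) : ENNReal) ℝ (ι → ℝ)).symm.toLinearMap, fun f => ?_⟩
  have h0 : (((2 * m : ℕ) : ENNReal)).toReal = ((2 * m : ℕ) : ℝ) := ENNReal.toReal_natCast _
  have hpos : (0 : ℝ) < ((2 * m : ℕ) : ℝ) := by exact_mod_cast (by omega : 0 < 2 * m)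
  rw [Seminorm.comp_apply, coe_normSeminorm, PiLp.norm_eq_sum (by rw [h0]; exact hpos), h0, one_div,
    Real.rpow_inv_natCast_pow (Finset.sum_nonneg fun _ _ => by positivity) (by omega)]
  refine Finset.sum_congr rfl fun x _ => ?_
  rw [Real.rpow_natCast, Real.norm_eq_abs, (even_two_mul m).pow_abs]
  rfl

/-- Averaging over all translates by differences of elements of `X`, i.e. convolution with
`μ_X * μ_{-X}`. -/
noncomputable def diffAvg (X : Finset G) : (G → ℝ) →ₗ[ℝ] (G → ℝ) :=
  ((X.card : ℝ) ^ 2)⁻¹ • ∑ u ∈ X ×ˢ X, LinearMap.funLeft ℝ ℝ fun x => x - (u.1 - u.2)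

lemma diffAvg_eq (X : Finset G) (f : G → ℝ) :
    diffAvg X f = ((X.card : ℝ) ^ 2)⁻¹ • ∑ u ∈ X ×ˢ X, fun x => f (x - (u.1 - u.2)) := by
  ext x
  simp [diffAvg, LinearMap.funLeft_apply]

lemma diffAvg_apply (X : Finset G) (f : G → ℝ) (x : G) :
    diffAvg X f x = ((X.card : ℝ) ^ 2)⁻¹ * ∑ u ∈ X ×ˢ X, f (x - (u.1 - u.2)) := by
  simp [diffAvg_eq]

lemma diffAvg_const_bound (X : Finset G) (hX : X.Nonempty) (r : ℝ) :
    ((X.card : ℝ) ^ 2)⁻¹ * ∑ _u ∈ X ×ˢ X, r = r := by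
  have : (X.card : ℝ) ≠ 0 := Nat.cast_ne_zero.2 hX.card_ne_zero
  rw [Finset.sum_const, Finset.card_product, nsmul_eq_mul]
  push_cast
  field_simp

lemma diffAvg_iterate_nonneg (X : Finset G) {f : G → ℝ} (hf : ∀ x, 0 ≤ f x) (j : ℕ) (x : G) :
    0 ≤ (diffAvg X)^[j] f x := by
  induction j generalizing x with
  | zero => exact hf x
  | succ j ih =>
    rw [Function.iterate_succ_apply', diffAvg_apply]
    exact mul_nonneg (by positivity) (Finset.sum_nonneg fun u _ => ih _)

lemma seminorm_average_le (N : Seminorm ℝ (G → ℝ)) (X : Finset G) (hX : X.Nonempty) (r : ℝ)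
    (g : G × G → G → ℝ) (hg : ∀ u ∈ X ×ˢ X, N (g u) ≤ r) :
    N (((X.card : ℝ) ^ 2)⁻¹ • ∑ u ∈ X ×ˢ X, g u) ≤ r := by
  rw [map_smul_eq_mul, Real.norm_of_nonneg (by positivity), ← diffAvg_const_bound X hX r]
  gcongr
  refine (Finset.le_sum_of_subadditive N (map_zero N).le (map_add_le_add N) _ _).trans ?_
  exact Finset.sum_le_sum hg

/-- If the elements of `X` translate `f` almost identically, then `f` is almost invariant under
iterated averaging over `X - X`. -/
lemma seminorm_diffAvg_iterate_sub_le (N : Seminorm ℝ (G → ℝ))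
    (hN : ∀ f t, N (fun x => f (x - t)) = N f) (X : Finset G) (hX : X.Nonempty) (f : G → ℝ) (r : ℝ)
    (hf : ∀ s ∈ X, ∀ t ∈ X, N ((fun x => f (x - s)) - fun x => f (x - t)) ≤ r) (j : ℕ) :
    N ((diffAvg X)^[j] f - f) ≤ j * r := by
  have hcontr (g : G → ℝ) : N (diffAvg X g) ≤ N g := by
    rw [diffAvg_eq]
    exact seminorm_average_le N X hX _ _ fun u _ => (hN g _).le
  have hone : N (diffAvg X f - f) ≤ r := by
    have h : diffAvg X f - f = ((X.card : ℝ) ^ 2)⁻¹ • ∑ u ∈ X ×ˢ X,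
        ((fun x => f (x - (u.1 - u.2))) - f) := by
      ext x
      have := diffAvg_const_bound X hX (f x)
      rw [Pi.sub_apply, diffAvg_apply]
      nth_rewrite 1 [← this]
      simp [mul_sub]
    rw [h]
    refine seminorm_average_le N X hX _ _ fun u hu => ?_
    rw [Finset.mem_product] at hu
    refine le_of_eq_of_le ?_ (hf u.1 hu.1 u.2 hu.2)
    rw [← hN ((fun x => f (x - (u.1 - u.2))) - f) u.2]
    congr 1
    ext x
    simp only [Pi.sub_apply]
    congr 2
    abel
  induction j with
  | zero => simp
  | succ j ih =>
    have h : (diffAvg X)^[j + 1] f - f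
        = diffAvg X ((diffAvg X)^[j] f - f) + (diffAvg X f - f) := by
      rw [Function.iterate_succ_apply', map_sub]; abel
    rw [h]
    push_cast
    linarith [map_add_le_add N (diffAvg X ((diffAvg X)^[j] f - f)) (diffAvg X f - f),
      hcontr ((diffAvg X)^[j] f - f)]

/-- Croot–Sisask almost-periodicity in `L^{2m}`: a dense set of elements translates `μ_A * 1_A`
almost identically. -/
lemma exists_almost_periods (A : Finset G) (hA : A.Nonempty) (m k l : ℕ) (hm : 1 ≤ m) (hl : 1 ≤ l)
    (K : ℝ) (hK : 0 < K)
    (hnorm : ∑ x, conv (nind A) (ind A) x ^ (2 * m) = Fintype.card G * K ^ (2 * m))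
    (hk : 6144 * (l : ℝ) ^ 2 * m ≤ k * K) (N : Seminorm ℝ (G → ℝ))
    (hN : ∀ f, N f ^ (2 * m) = ∑ x, f x ^ (2 * m)) :
    ∃ X : Finset G, (A.card : ℝ) ^ k * Fintype.card G ≤ 2 * Fintype.card G ^ k * X.card ∧
      ∀ s ∈ X, ∀ t ∈ X, N ((fun x => conv (nind A) (ind A) (x - s))
        - fun x => conv (nind A) (ind A) (x - t)) ≤ N (conv (nind A) (ind A)) / (4 * l) := by
  have hm0 : (1 : ℝ) ≤ m := by exact_mod_cast hm
  have hl0 : (1 : ℝ) ≤ l := by exact_mod_cast hl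
  have hl2 : 1 ≤ (l : ℝ) ^ 2 := one_le_pow₀ hl0
  have hG : (0 : ℝ) < Fintype.card G := Nat.cast_pos.2 Fintype.card_pos
  have hkK : 0 < k * K := lt_of_lt_of_le (by positivity) hk
  have hk0 : (0 : ℝ) < k := pos_of_mul_pos_left hkK hK.le
  have hmk : (m : ℝ) ≤ k * K := le_trans (by nlinarith) hk
  have h2m : 2 * m ≠ 0 := by omega
  have hinv (f : G → ℝ) (t : G) : N (fun x => f (x - t)) = N f := by
    refine (pow_left_inj₀ (apply_nonneg N _) (apply_nonneg N _) h2m).1 ?_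
    rw [hN, hN]
    exact Equiv.sum_comp (Equiv.subRight t) fun x => f x ^ (2 * m)
  have hmom := sum_sum_sampling_error_le A hA m k hm K hK hnorm hmk
  set p := conv (nind A) (ind A) with hp
  set s := Fintype.piFinset fun _ : Fin k => A with hs
  have hcard : (s.card : ℝ) = (A.card : ℝ) ^ k := by simp [hs]
  set T := s.filter fun a => ∑ x, (∑ i, (ind A (x - a i) - p x)) ^ (2 * m)
    ≤ 2 * (4 * Fintype.card G * (12 * m * k * K) ^ m) with hT
  have hTcard : (A.card : ℝ) ^ k ≤ 2 * T.card := by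
    rw [← hcard] at hmom ⊢
    exact card_le_two_mul_card_filter s _ _ (by positivity)
      (fun a => Finset.sum_nonneg fun x _ => (even_two_mul m).pow_nonneg _) hmom
  set g : (Fin k → G) → G → ℝ := fun a x => (k : ℝ)⁻¹ * ∑ i, ind A (x - a i) with hg
  have hgood : ∀ a ∈ T, N (g a - p) ≤ N p / (8 * l) := by
    intro a ha
    have ha' := (Finset.mem_filter.1 ha).2
    refine le_of_pow_le_pow_left₀ h2m (div_nonneg (apply_nonneg N _) (by positivity)) ?_
    rw [div_pow, hN, hN, hnorm, le_div_iff₀ (by positivity)]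
    have h1 : ∀ x, (g a - p) x ^ (2 * m)
        = ((k : ℝ)⁻¹) ^ (2 * m) * (∑ i, (ind A (x - a i) - p x)) ^ (2 * m) := by
      intro x
      rw [← mul_pow]
      congr 1
      simp [hg, mul_sub, hk0.ne']
    simp only [h1]
    rw [← Finset.mul_sum]
    have h8 : (8 : ℝ) ≤ 8 ^ m := le_self_pow₀ (by norm_num) (by omega)
    calc _ ≤ ((k : ℝ)⁻¹) ^ (2 * m) * (2 * (4 * Fintype.card G * (12 * m * k * K) ^ m))
          * (8 * l) ^ (2 * m) := by gcongr
      _ = Fintype.card G * (8 * (((k : ℝ)⁻¹) ^ (2 * m) * (12 * m * k * K) ^ m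
          * (8 * l) ^ (2 * m))) := by ring
      _ ≤ Fintype.card G * (8 ^ m * (((k : ℝ)⁻¹) ^ (2 * m) * (12 * m * k * K) ^ m
          * (8 * l) ^ (2 * m))) := by gcongr
      _ = Fintype.card G * (6144 * (l : ℝ) ^ 2 * m * ((k : ℝ)⁻¹ * K)) ^ m := by
          rw [pow_mul, pow_mul, ← mul_pow, ← mul_pow, ← mul_pow]
          congr 2
          field_simp
          ring
      _ ≤ Fintype.card G * (k * K * ((k : ℝ)⁻¹ * K)) ^ m := by gcongr
      _ = Fintype.card G * K ^ (2 * m) := by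
          rw [pow_mul]
          congr 2
          field_simp
  obtain ⟨b, hb⟩ := exists_many_diagonal_translates k T
  refine ⟨Finset.univ.filter fun t : G => (fun i => b i - t) ∈ T, ?_, ?_⟩
  · nlinarith
  · have hclose : ∀ t ∈ Finset.univ.filter fun t : G => (fun i => b i - t) ∈ T,
        N (g b - fun x => p (x - t)) ≤ N p / (8 * l) := by
      intro t ht
      refine le_of_eq_of_le ?_ (hgood _ (Finset.mem_filter.1 ht).2)
      rw [← hinv (g (fun i => b i - t) - p) t]
      congr 1
      ext x
      simp only [Pi.sub_apply, hg]
      congr 3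
      ext i
      congr 1
      abel
    intro s hs t ht
    have h1 := map_sub_le_add N (g b - fun x => p (x - t)) (g b - fun x => p (x - s))
    rw [sub_sub_sub_cancel_left] at h1
    have h2 : N p / (8 * l) + N p / (8 * l) = N p / (4 * l) := by ring
    linarith [hclose s hs, hclose t ht]

/-- The characters of `𝔽₃ⁿ`, indexed by `𝔽₃ⁿ` itself through the dot product. -/
noncomputable def dotChar (n : ℕ) : (Fin n → ZMod 3) →+ AddChar (Fin n → ZMod 3) ℂ where
  toFun v :=
    { toFun := fun x => ZMod.stdAddChar (v ⬝ᵥ x)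
      map_zero_eq_one' := by simp
      map_add_eq_mul' := fun x y => by rw [dotProduct_add, AddChar.map_add_eq_mul] }
  map_zero' := by ext x; simp
  map_add' v w := by ext x; simp [add_dotProduct, AddChar.map_add_eq_mul]

lemma dotChar_apply {n : ℕ} (v x : Fin n → ZMod 3) :
    dotChar n v x = ZMod.stdAddChar (v ⬝ᵥ x) := rfl

lemma dotChar_comm {n : ℕ} (v x : Fin n → ZMod 3) : dotChar n v x = dotChar n x v := by
  rw [dotChar_apply, dotChar_apply, dotProduct_comm]

lemma dotChar_apply_eq_one_iff {n : ℕ} (v x : Fin n → ZMod 3) :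
    dotChar n v x = 1 ↔ v ⬝ᵥ x = 0 := by
  rw [dotChar_apply, ← AddChar.map_zero_eq_one (ZMod.stdAddChar (N := 3)),
    ZMod.injective_stdAddChar.eq_iff]

lemma dotChar_injective (n : ℕ) : Function.Injective (dotChar n) := by
  rw [injective_iff_map_eq_zero]
  intro v hv
  refine dotProduct_eq_zero_iff.1 fun x => ?_
  rw [← dotChar_apply_eq_one_iff, hv, AddChar.zero_apply]

lemma dotChar_bijective (n : ℕ) : Function.Bijective (dotChar n) :=
  (Fintype.bijective_iff_injective_and_card _).2 ⟨dotChar_injective n, AddChar.card_eq.symm⟩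

lemma norm_dotChar {n : ℕ} (v x : Fin n → ZMod 3) : ‖dotChar n v x‖ = 1 := AddChar.norm_apply _ _

lemma sum_dotChar {n : ℕ} (x : Fin n → ZMod 3) :
    ∑ v, dotChar n v x = if x = 0 then (Fintype.card (Fin n → ZMod 3) : ℂ) else 0 := by
  simp only [dotChar_comm _ x]
  rw [AddChar.sum_eq_ite]
  simp [map_eq_zero_iff _ (dotChar_injective n)]

/-- The Fourier coefficient of `μ_X` at `v`. -/
noncomputable def meanChar {n : ℕ} (X : Finset (Fin n → ZMod 3)) (v : Fin n → ZMod 3) : ℂ :=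
  (∑ x ∈ X, dotChar n v x) / X.card

lemma addDissociated_image_dotChar {n : ℕ} (S : Finset (Fin n → ZMod 3))
    (hS : LinearIndependent (ZMod 3) ((↑) : S → Fin n → ZMod 3)) :
    AddDissociated (dotChar n '' S) := by
  have hS' : AddDissociated (S : Set (Fin n → ZMod 3)) := by
    intro t ht u hu htu
    simp only [Set.mem_ofPred_eq] at ht hu
    have hS2 := (linearIndepOn_finset_iff (R := ZMod 3) (s := S) (v := id)).1 hS
    have h := hS2 (fun i => (if i ∈ t then 1 else 0) - (if i ∈ u then 1 else 0)) (by
      simp only [sub_smul, ite_smul, one_smul, zero_smul, id, Finset.sum_sub_distrib,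
        Finset.sum_ite_mem]
      rw [Finset.inter_eq_right.2 (by exact_mod_cast ht),
        Finset.inter_eq_right.2 (by exact_mod_cast hu)]
      exact sub_eq_zero.2 htu)
    ext i
    by_cases hi : i ∈ S
    · have := h i hi
      by_cases h1 : i ∈ t <;> by_cases h2 : i ∈ u <;> simp_all
    · exact ⟨fun h => absurd (ht h) hi, fun h => absurd (hu h) hi⟩
  intro t ht u hu htu
  simp only [Set.mem_ofPred_eq] at ht hu
  obtain ⟨t', ht', rfl⟩ := Finset.subset_set_image_iff.1 ht
  obtain ⟨u', hu', rfl⟩ := Finset.subset_set_image_iff.1 hu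
  simp only at htu
  rw [Finset.sum_image (dotChar_injective n).injOn, Finset.sum_image (dotChar_injective n).injOn,
    ← map_sum, ← map_sum] at htu
  rw [hS' ht' hu' (dotChar_injective n htu)]

lemma sum_prod_dotChar {n : ℕ} (S : Finset (Fin n → ZMod 3))
    (hS : LinearIndependent (ZMod 3) ((↑) : S → Fin n → ZMod 3)) (a : ℝ)
    (d : (Fin n → ZMod 3) → ℂ) :
    ∑ x, ∏ v ∈ S, (a + (d v * dotChar n v x).re)
      = Fintype.card (Fin n → ZMod 3) * a ^ S.card := by
  set e := Equiv.ofBijective _ (dotChar_bijective n) with he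
  have h := AddDissociated.randomisation (G := Fin n → ZMod 3)
    (fun ψ => if e.symm ψ ∈ S then a else 1) (fun ψ => if e.symm ψ ∈ S then d (e.symm ψ) else 0)
    ((addDissociated_image_dotChar S hS).subset fun ψ hψ => by
      refine ⟨e.symm ψ, ?_, e.apply_symm_apply ψ⟩
      by_contra h
      exact hψ (if_neg h))
  have h1 (x : Fin n → ZMod 3) : ∏ ψ, ((if e.symm ψ ∈ S then a else 1)
      + ((if e.symm ψ ∈ S then d (e.symm ψ) else 0) * ψ x).re)
      = ∏ v ∈ S, (a + (d v * dotChar n v x).re) := by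
    rw [← Equiv.prod_comp e]
    simp only [Equiv.symm_apply_apply]
    rw [← Finset.prod_subset (Finset.subset_univ S)]
    · refine Finset.prod_congr rfl fun v hv => ?_
      rw [if_pos hv, if_pos hv]; rfl
    · intro v _ hv
      rw [if_neg hv, if_neg hv]; simp
  have h2 : ∏ ψ, (if e.symm ψ ∈ S then a else 1) = a ^ S.card := by
    rw [← Equiv.prod_comp e]
    simp only [Equiv.symm_apply_apply]
    rw [Finset.prod_ite_mem, Finset.univ_inter, Finset.prod_const]
  simp only [h1] at h
  rw [h2, Fintype.expect_eq_sum_div_card, div_eq_iff (by simp)] at h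
  rw [h, mul_comm]

/-- Chang's theorem over `𝔽₃ⁿ`: independent large Fourier coefficients of a dense set are few. -/
lemma card_le_of_linearIndependent_large_spectrum {n : ℕ} (X : Finset (Fin n → ZMod 3))
    (hX : X.Nonempty) (S : Finset (Fin n → ZMod 3))
    (hS : LinearIndependent (ZMod 3) ((↑) : S → Fin n → ZMod 3))
    (hlarge : ∀ v ∈ S, 1 / 2 ≤ ‖meanChar X v‖) :
    (S.card : ℝ) ≤ 8 * Real.log (Fintype.card (Fin n → ZMod 3) / X.card) := by
  have hX0 : (0 : ℝ) < X.card := Nat.cast_pos.2 hX.card_pos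
  have hphase (z : ℂ) : ∃ c : ℂ, ‖c‖ = 1 ∧ c * z = ‖z‖ := by
    by_cases hz : z = 0
    · exact ⟨1, by simp [hz]⟩
    · have hz' : (‖z‖ : ℂ) ≠ 0 := by simpa using hz
      refine ⟨(starRingEnd ℂ) z / ‖z‖, by simp [hz], ?_⟩
      rw [div_mul_eq_mul_div, Complex.conj_mul']
      field_simp
  choose c hc1 hc2 using fun v => hphase (meanChar X v)
  set F : (Fin n → ZMod 3) → ℝ := fun x => ∑ v ∈ S, (c v * dotChar n v x).re with hF
  have hFsum : X.card * ((S.card : ℝ) / 2) ≤ ∑ x ∈ X, F x := by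
    rw [hF, Finset.sum_comm]
    have h1 (v) : ∑ x ∈ X, (c v * dotChar n v x).re = X.card * ‖meanChar X v‖ := by
      rw [← Complex.re_sum, ← Finset.mul_sum]
      have h2 : ∑ x ∈ X, dotChar n v x = X.card * meanChar X v := by
        rw [meanChar, mul_div_cancel₀]
        exact_mod_cast hX0.ne'
      rw [h2, mul_left_comm, hc2]
      norm_cast
    simp only [h1]
    rw [← Finset.mul_sum]
    gcongr
    have := Finset.card_nsmul_le_sum S _ _ hlarge
    rw [nsmul_eq_mul] at this
    linarith
  have hlow : X.card * Real.exp ((S.card : ℝ) / 4) ≤ ∑ x ∈ X, Real.exp (F x / 2) := by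
    have h1 : ∀ x ∈ X, Real.exp ((S.card : ℝ) / 4) * (1 + (F x / 2 - (S.card : ℝ) / 4))
        ≤ Real.exp (F x / 2) := by
      intro x _
      have := Real.add_one_le_exp (F x / 2 - (S.card : ℝ) / 4)
      calc _ ≤ Real.exp ((S.card : ℝ) / 4) * Real.exp (F x / 2 - (S.card : ℝ) / 4) := by
            gcongr; linarith
        _ = _ := by rw [← Real.exp_add]; ring_nf
    refine le_trans ?_ (Finset.sum_le_sum h1)
    rw [← Finset.mul_sum, mul_comm]
    gcongr
    rw [Finset.sum_add_distrib, Finset.sum_sub_distrib, ← Finset.sum_div]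
    simp only [Finset.sum_const, nsmul_eq_mul]
    linarith
  have hup : ∑ x ∈ X, Real.exp (F x / 2)
      ≤ Fintype.card (Fin n → ZMod 3) * Real.exp ((S.card : ℝ) / 8) := by
    calc _ ≤ ∑ x, Real.exp (F x / 2) := Finset.sum_le_sum_of_subset_of_nonneg
          (Finset.subset_univ _) fun _ _ _ => (Real.exp_pos _).le
      _ ≤ ∑ x, ∏ v ∈ S, (Real.cosh (1 / 2)
            + (((Real.sinh (1 / 2) : ℝ) * c v) * dotChar n v x).re) := by
          refine Finset.sum_le_sum fun x _ => ?_
          rw [hF, Finset.sum_div, Real.exp_sum]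
          refine Finset.prod_le_prod (fun _ _ => (Real.exp_pos _).le) fun v _ => ?_
          have h1 : |(c v * dotChar n v x).re| ≤ 1 :=
            (Complex.abs_re_le_norm _).trans_eq (by rw [norm_mul, hc1, norm_dotChar, one_mul])
          have h2 := Real.exp_mul_le_cosh_add_mul_sinh h1 (1 / 2)
          rw [mul_assoc, Complex.re_ofReal_mul, mul_comm (Real.sinh _), div_eq_mul_one_div]
          exact h2
      _ = Fintype.card (Fin n → ZMod 3) * Real.cosh (1 / 2) ^ S.card := sum_prod_dotChar S hS _ _
      _ ≤ Fintype.card (Fin n → ZMod 3) * Real.exp ((1 / 2) ^ 2 / 2) ^ S.card := by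
          gcongr
          exact Real.cosh_le_exp_half_sq _
      _ = _ := by rw [← Real.exp_nat_mul]; ring_nf
  have h := hlow.trans hup
  have h2 : Real.exp ((S.card : ℝ) / 8) ≤ Fintype.card (Fin n → ZMod 3) / X.card := by
    rw [le_div_iff₀ hX0]
    have h3 : Real.exp ((S.card : ℝ) / 4)
        = Real.exp ((S.card : ℝ) / 8) * Real.exp ((S.card : ℝ) / 8) := by
      rw [← Real.exp_add]; ring_nf
    rw [h3, ← mul_assoc] at h
    have := le_of_mul_le_mul_right h (Real.exp_pos _)
    linarith
  have := (Real.le_log_iff_exp_le (lt_of_lt_of_le (Real.exp_pos _) h2)).2 h2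
  linarith

lemma ind_eq_sum_dotChar {n : ℕ} (A : Finset (Fin n → ZMod 3)) (x : Fin n → ZMod 3) :
    (ind A x : ℂ) = (∑ v, ∑ a ∈ A, dotChar n v (x - a)) / Fintype.card (Fin n → ZMod 3) := by
  rw [eq_div_iff (by simp), Finset.sum_comm]
  simp only [sum_dotChar, sub_eq_zero, Finset.sum_ite_eq]
  unfold ind
  split_ifs <;> simp

lemma sum_normSq_sum_dotChar {n : ℕ} (A : Finset (Fin n → ZMod 3)) :
    ∑ v, ‖∑ a ∈ A, dotChar n v (-a)‖ ^ 2 = Fintype.card (Fin n → ZMod 3) * A.card := by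
  have h (v) : (((‖∑ a ∈ A, dotChar n v (-a)‖ ^ 2 : ℝ)) : ℂ)
      = ∑ a ∈ A, ∑ b ∈ A, dotChar n v (a - b) := by
    push_cast
    rw [← Complex.conj_mul', map_sum, Finset.sum_mul_sum]
    refine Finset.sum_congr rfl fun a _ => Finset.sum_congr rfl fun b _ => ?_
    rw [← AddChar.map_neg_eq_conj, neg_neg, ← AddChar.map_add_eq_mul, sub_eq_add_neg]
  apply Complex.ofReal_injective
  rw [Complex.ofReal_sum]
  simp only [h]
  rw [Finset.sum_comm]
  have h2 : ∀ a ∈ A, ∑ v, ∑ b ∈ A, dotChar n v (a - b) = Fintype.card (Fin n → ZMod 3) := by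
    intro a ha
    rw [Finset.sum_comm]
    simp only [sum_dotChar, sub_eq_zero, Finset.sum_ite_eq, if_pos ha]
  rw [Finset.sum_congr rfl h2]
  simp [mul_comm]

/-- `μ_A * 1_A` has absolutely summable Fourier coefficients with sum `1`. -/
lemma exists_fourier_expansion_conv {n : ℕ} (A : Finset (Fin n → ZMod 3)) (hA : A.Nonempty) :
    ∃ c : (Fin n → ZMod 3) → ℂ, ∑ v, ‖c v‖ = 1 ∧
      ∀ x, (conv (nind A) (ind A) x : ℂ) = ∑ v, c v * dotChar n v x := by
  have hA0 : (A.card : ℝ) ≠ 0 := Nat.cast_ne_zero.2 hA.card_ne_zero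
  have hG0 : (Fintype.card (Fin n → ZMod 3) : ℝ) ≠ 0 := Nat.cast_ne_zero.2 Fintype.card_ne_zero
  refine ⟨fun v => (∑ a ∈ A, dotChar n v (-a)) ^ 2 / (Fintype.card (Fin n → ZMod 3) * A.card),
    ?_, fun x => ?_⟩
  · simp only [norm_div, norm_pow, norm_mul, Complex.norm_natCast]
    rw [← Finset.sum_div, sum_normSq_sum_dotChar, div_self (mul_ne_zero hG0 hA0)]
  · rw [conv_nind_ind]
    push_cast
    simp only [ind_eq_sum_dotChar]
    rw [← Finset.sum_div, Finset.sum_comm, div_div, Finset.sum_div]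
    refine Finset.sum_congr rfl fun v _ => ?_
    rw [div_mul_eq_mul_div]
    congr 1
    rw [sq, Finset.sum_mul_sum, Finset.sum_mul]
    refine Finset.sum_congr rfl fun a _ => ?_
    rw [Finset.sum_mul]
    refine Finset.sum_congr rfl fun b _ => ?_
    rw [← AddChar.map_add_eq_mul, ← AddChar.map_add_eq_mul]
    congr 1
    abel

lemma fourier_expansion_diffAvg {n : ℕ} (X : Finset (Fin n → ZMod 3))
    {f : (Fin n → ZMod 3) → ℝ} {c : (Fin n → ZMod 3) → ℂ}
    (hf : ∀ x, (f x : ℂ) = ∑ v, c v * dotChar n v x) (x : Fin n → ZMod 3) :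
    (diffAvg X f x : ℂ) = ∑ v, c v * (‖meanChar X v‖ : ℂ) ^ 2 * dotChar n v x := by
  have h (v) : (‖meanChar X v‖ : ℂ) ^ 2
      = ((X.card : ℂ) ^ 2)⁻¹ * ∑ u ∈ X ×ˢ X, dotChar n v (-(u.1 - u.2)) := by
    rw [← Complex.conj_mul', meanChar, map_div₀, map_sum, Finset.sum_product, Complex.conj_natCast,
      div_mul_div_comm, Finset.sum_mul_sum, div_eq_inv_mul, sq]
    congr 1
    refine Finset.sum_congr rfl fun a _ => Finset.sum_congr rfl fun b _ => ?_
    rw [← AddChar.map_neg_eq_conj, ← AddChar.map_add_eq_mul, neg_sub, sub_eq_neg_add]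
  rw [diffAvg_apply]
  push_cast
  simp only [hf, h]
  rw [Finset.sum_comm, Finset.mul_sum]
  refine Finset.sum_congr rfl fun v _ => ?_
  rw [mul_left_comm, mul_assoc, mul_assoc (c v), Finset.sum_mul, ← Finset.mul_sum]
  congr 2
  refine Finset.sum_congr rfl fun u _ => ?_
  rw [sub_eq_add_neg x, AddChar.map_add_eq_mul, mul_comm]

lemma fourier_expansion_diffAvg_iterate {n : ℕ} (X : Finset (Fin n → ZMod 3))
    {f : (Fin n → ZMod 3) → ℝ} {c : (Fin n → ZMod 3) → ℂ}
    (hf : ∀ x, (f x : ℂ) = ∑ v, c v * dotChar n v x) (j : ℕ) (x : Fin n → ZMod 3) :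
    ((diffAvg X)^[j] f x : ℂ) = ∑ v, c v * (‖meanChar X v‖ : ℂ) ^ (2 * j) * dotChar n v x := by
  induction j generalizing x with
  | zero => simpa using hf x
  | succ j ih =>
    rw [Function.iterate_succ_apply', fourier_expansion_diffAvg X ih]
    refine Finset.sum_congr rfl fun v _ => ?_
    ring

/-- Iterated averages of `μ_A * 1_A` over `X - X` are almost invariant under translation by
elements annihilated by the large spectrum of `X`. -/
lemma abs_diffAvg_iterate_sub_le {n : ℕ} (A : Finset (Fin n → ZMod 3)) (hA : A.Nonempty)
    (X : Finset (Fin n → ZMod 3)) (j : ℕ) (u : Fin n → ZMod 3)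
    (hu : ∀ v, 1 / 2 ≤ ‖meanChar X v‖ → v ⬝ᵥ u = 0) (x : Fin n → ZMod 3) :
    |(diffAvg X)^[j] (conv (nind A) (ind A)) (x + u) - (diffAvg X)^[j] (conv (nind A) (ind A)) x|
      ≤ 2 * (1 / 4) ^ j := by
  obtain ⟨c, hc, hf⟩ := exists_fourier_expansion_conv A hA
  rw [← Real.norm_eq_abs, ← Complex.norm_real, Complex.ofReal_sub,
    fourier_expansion_diffAvg_iterate X hf, fourier_expansion_diffAvg_iterate X hf,
    ← Finset.sum_sub_distrib]
  calc _ ≤ ∑ v, ‖c v‖ * (2 * (1 / 4) ^ j) := norm_sum_le_of_le _ fun v _ => ?_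
    _ = _ := by rw [← Finset.sum_mul, hc, one_mul]
  rw [← mul_sub, norm_mul, norm_mul, mul_assoc, norm_pow, Complex.norm_real, norm_norm]
  refine mul_le_mul_of_nonneg_left ?_ (norm_nonneg _)
  rcases le_or_gt (1 / 2) ‖meanChar X v‖ with h | h
  · rw [AddChar.map_add_eq_mul, (dotChar_apply_eq_one_iff v u).2 (hu v h), mul_one, sub_self,
      norm_zero, mul_zero]
    positivity
  · rw [mul_comm]
    refine mul_le_mul ?_ ?_ (by positivity) (by norm_num)
    · refine (norm_sub_le _ _).trans_eq ?_
      rw [norm_dotChar, norm_dotChar]; norm_num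
    · rw [pow_mul]
      refine pow_le_pow_left₀ (by positivity) ?_ j
      nlinarith [norm_nonneg (meanChar X v)]

/-- The common annihilator of the large spectrum of a dense set has small codimension. -/
lemma exists_submodule_annihilating_spectrum {n : ℕ} (X : Finset (Fin n → ZMod 3))
    (hX : X.Nonempty) :
    ∃ V : Submodule (ZMod 3) (Fin n → ZMod 3),
      (n : ℝ) - Module.finrank (ZMod 3) V
        ≤ 8 * Real.log (Fintype.card (Fin n → ZMod 3) / X.card) ∧
      ∀ u ∈ V, ∀ v, 1 / 2 ≤ ‖meanChar X v‖ → v ⬝ᵥ u = 0 := by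
  obtain ⟨b, hbs, hspan, hli⟩ :=
    exists_linearIndependent (ZMod 3) {v : Fin n → ZMod 3 | 1 / 2 ≤ ‖meanChar X v‖}
  obtain ⟨S, rfl⟩ : ∃ S : Finset (Fin n → ZMod 3), (S : Set (Fin n → ZMod 3)) = b :=
    ⟨b.toFinset, by simp⟩
  have hS := card_le_of_linearIndependent_large_spectrum X hX S hli fun v hv => hbs hv
  set L := (Matrix.of fun (v : S) (i : Fin n) => (v : Fin n → ZMod 3) i).mulVecLin with hL
  refine ⟨LinearMap.ker L, ?_, fun u hu v hv => ?_⟩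
  · refine le_trans ?_ hS
    have h1 := LinearMap.finrank_range_add_finrank_ker L
    have h2 := Submodule.finrank_le (LinearMap.range L)
    rw [Module.finrank_fintype_fun_eq_card, Fintype.card_coe] at h2
    rw [Module.finrank_fintype_fun_eq_card, Fintype.card_fin] at h1
    have h3 : n ≤ S.card + Module.finrank (ZMod 3) (LinearMap.ker L) := by omega
    have h4 : (n : ℝ) ≤ S.card + Module.finrank (ZMod 3) (LinearMap.ker L) := by exact_mod_cast h3
    linarith
  · have hmem : v ∈ Submodule.span (ZMod 3) (S : Set (Fin n → ZMod 3)) :=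
      hspan ▸ Submodule.subset_span hv
    clear hv
    induction hmem using Submodule.span_induction with
    | mem w hw => exact congrFun (LinearMap.mem_ker.1 hu) ⟨w, hw⟩
    | zero => exact zero_dotProduct u
    | add w z _ _ hw hz => rw [add_dotProduct, hw, hz, add_zero]
    | smul a w _ hw => rw [smul_dotProduct, hw, smul_zero]

lemma sum_diffAvg_iterate_le {H : Type*} [Fintype H] (X : Finset G) (hX : X.Nonempty)
    (φ : H → G) {f : G → ℝ} {M : ℝ} (hf : ∀ x, ∑ u, f (x + φ u) ≤ M) (j : ℕ) (x : G) :
    ∑ u, (diffAvg X)^[j] f (x + φ u) ≤ M := by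
  induction j generalizing x with
  | zero => exact hf x
  | succ j ih =>
    simp only [Function.iterate_succ_apply', diffAvg_apply]
    rw [← Finset.mul_sum, Finset.sum_comm, ← diffAvg_const_bound X hX M]
    gcongr with w
    refine le_of_eq_of_le ?_ (ih (x - (w.1 - w.2)))
    exact Finset.sum_congr rfl fun u _ => by rw [add_sub_right_comm]

lemma sum_conv_le (A : Finset G) (hA : A.Nonempty) {H : Type*} [Fintype H]
    (φ : H → G) {M : ℝ} (hf : ∀ x, ∑ u, ind A (x + φ u) ≤ M) (x : G) :
    ∑ u, conv (nind A) (ind A) (x + φ u) ≤ M := by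
  simp only [conv_nind_ind]
  rw [← Finset.sum_div, Finset.sum_comm, div_le_iff₀ (Nat.cast_pos.2 hA.card_pos), mul_comm,
    ← nsmul_eq_mul]
  refine Finset.sum_le_card_nsmul _ _ _ fun a _ => le_of_eq_of_le ?_ (hf (x - a))
  exact Finset.sum_congr rfl fun u _ => by rw [add_sub_right_comm]

lemma lpNorm_pow_mul_card (f : G → ℝ) (m : ℕ) (hm : 1 ≤ m) :
    ∑ x, f x ^ (2 * m) = Fintype.card G * lpNorm (2 * m) f ^ (2 * m) := by
  have hG : (Fintype.card G : ℝ) ≠ 0 := Nat.cast_ne_zero.2 Fintype.card_ne_zero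
  have hcast : (2 * m : ℝ) = ((2 * m : ℕ) : ℝ) := by push_cast; rfl
  have h0 : 0 ≤ expect fun x => |f x| ^ (2 * m : ℝ) :=
    div_nonneg (Finset.sum_nonneg fun x _ => by positivity) (Nat.cast_nonneg _)
  rw [lpNorm, one_div, hcast, Real.rpow_inv_natCast_pow (hcast ▸ h0) (by omega), expect,
    mul_div_cancel₀ _ hG]
  simp only [Real.rpow_natCast, (even_two_mul m).pow_abs]

lemma lpNorm_conv_nind_ind_le_one (A : Finset G) (m : ℕ) (hm : 1 ≤ m) :
    lpNorm (2 * m) (conv (nind A) (ind A)) ≤ 1 := by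
  have hG : (0 : ℝ) < Fintype.card G := Nat.cast_pos.2 Fintype.card_pos
  have h := lpNorm_pow_mul_card (conv (nind A) (ind A)) m hm
  have h1 : ∑ x, conv (nind A) (ind A) x ^ (2 * m) ≤ Fintype.card G := by
    simpa using Finset.sum_le_card_nsmul Finset.univ
      (fun x => conv (nind A) (ind A) x ^ (2 * m)) 1 fun x _ =>
        pow_le_one₀ (conv_nind_ind_nonneg A x) (conv_nind_ind_le_one A x)
  have h2 : lpNorm (2 * m) (conv (nind A) (ind A)) ^ (2 * m) ≤ 1 ^ (2 * m) := by
    rw [one_pow]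
    exact le_of_mul_le_mul_left (by linarith) hG
  exact le_of_pow_le_pow_left₀ (by omega) zero_le_one h2

/-- If iterated averaging moves a nonnegative function by at most a quarter of its `L^{2m}` norm,
then the averaged function is somewhere at least three quarters of this norm. -/
lemma exists_three_quarters_le (N : Seminorm ℝ (G → ℝ)) (m : ℕ) (hm : 1 ≤ m)
    (hN : ∀ f, N f ^ (2 * m) = ∑ x, f x ^ (2 * m)) (f h : G → ℝ) (hh : ∀ x, 0 ≤ h x) (K : ℝ)
    (hf : ∑ x, f x ^ (2 * m) = Fintype.card G * K ^ (2 * m))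
    (hclose : N (h - f) ≤ N f / 4) : ∃ x, 3 / 4 * K ≤ h x := by
  by_contra! hlt
  have h1 : 3 / 4 * N f ≤ N h := by
    have := map_sub_rev N h f
    have := map_add_le_add N h (f - h)
    rw [add_sub_cancel] at this
    linarith
  have h2 : (3 / 4 * N f) ^ (2 * m) ≤ N h ^ (2 * m) := by gcongr
  rw [mul_pow, hN, hN, hf] at h2
  have h3 : ∑ x, h x ^ (2 * m) < ∑ _x : G, (3 / 4 * K) ^ (2 * m) :=
    Finset.sum_lt_sum_of_nonempty Finset.univ_nonempty fun x _ =>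
      pow_lt_pow_left₀ (hlt x) (hh x) (by omega)
  rw [Finset.sum_const, nsmul_eq_mul, mul_pow, Finset.card_univ] at h3
  linarith

lemma codim_bound {α L k m : ℝ} (hα : 0 < α) (hα1 : α ≤ 1) (hL : 1 ≤ L) (hm : 1 ≤ m)
    (hk : k ≤ 6144 * (2 * L) ^ 2 * m / α + 1) :
    8 * (Real.log 2 + k * L) ≤ 200000 * L ^ (200000 : ℝ) * m / α := by
  have hlog : Real.log 2 ≤ 1 := by linarith [Real.log_two_lt_d9]
  have hL3 : L ^ 3 ≤ L ^ (200000 : ℝ) := by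
    rw [← Real.rpow_natCast]
    exact Real.rpow_le_rpow_of_exponent_le hL (by norm_num)
  have hmα : 1 ≤ m / α := (one_le_div hα).2 (hα1.trans hm)
  have hL31 : L ≤ L ^ 3 := le_self_pow₀ hL (by norm_num)
  have hA : L ^ 3 ≤ L ^ 3 * (m / α) := le_mul_of_one_le_right (by positivity) hmα
  calc 8 * (Real.log 2 + k * L) ≤ 8 * (L + (6144 * (2 * L) ^ 2 * m / α + 1) * L) := by
        gcongr
        linarith
    _ = 196608 * (L ^ 3 * (m / α)) + 16 * L := by ring
    _ ≤ 200000 * (L ^ 3 * (m / α)) := by linarith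
    _ ≤ 200000 * (L ^ (200000 : ℝ) * (m / α)) := by gcongr
    _ = _ := by ring

/-- If `‖μ_A * 1_A‖_{L^{2m}} ≥ 10α` for a set `A ⊆ 𝔽₃ⁿ` of density `α ≤ 1/2`, then `A` has
density at least `5α` on a coset of a subspace of codimension `≲_α m/α`. -/
theorem large_convolution_norm_increment :
    ∃ C : ℝ, 0 < C ∧
      ∀ (n : ℕ) (A : Finset (Fin n → ZMod 3)) (m : ℕ), 1 ≤ m →
        A.Nonempty → (A.card : ℝ) / 3 ^ n ≤ 1 / 2 →
        lpNorm (2 * m) (conv (nind A) (ind A)) ≥ 10 * ((A.card : ℝ) / 3 ^ n) →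
        ∃ V : Submodule (ZMod 3) (Fin n → ZMod 3),
          (n : ℝ) - Module.finrank (ZMod 3) V ≤
            C * (Real.log (1 / ((A.card : ℝ) / 3 ^ n))) ^ C * m / ((A.card : ℝ) / 3 ^ n) ∧
          ∃ x : Fin n → ZMod 3,
            ((A.filter fun a => a - x ∈ V).card : ℝ) / Nat.card V ≥
              5 * ((A.card : ℝ) / 3 ^ n) := by
  refine ⟨200000, by norm_num, fun n A m hm hA _ hnorm => ?_⟩
  have hcardG : (Fintype.card (Fin n → ZMod 3) : ℝ) = 3 ^ n := by simp
  set α : ℝ := (A.card : ℝ) / 3 ^ n with hα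
  set p := conv (nind A) (ind A) with hp
  set K := lpNorm (2 * m) p with hKdef
  have hA0 : (0 : ℝ) < A.card := Nat.cast_pos.2 hA.card_pos
  have hα0 : 0 < α := by positivity
  have hK0 : 0 < K := by linarith
  have hα1 : α ≤ 1 / 10 := by linarith [lpNorm_conv_nind_ind_le_one A m hm]
  have hpK := lpNorm_pow_mul_card p m hm
  set L := Real.log (1 / α) with hL
  have hL1 : 1 ≤ L := by
    rw [hL, Real.le_log_iff_exp_le (by positivity)]
    refine Real.exp_one_lt_d9.le.trans ?_
    rw [le_div_iff₀ hα0]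
    linarith
  set l := ⌈L⌉₊ with hl
  have hlL : L ≤ l := Nat.le_ceil L
  have hl2 : (l : ℝ) ≤ 2 * L := by linarith [Nat.ceil_lt_add_one (zero_le_one.trans hL1)]
  have hl1 : 1 ≤ l := Nat.one_le_ceil_iff.2 (by linarith)
  have hl0 : (0 : ℝ) < l := Nat.cast_pos.2 hl1
  set k := ⌈6144 * (l : ℝ) ^ 2 * m / α⌉₊ with hk
  have hkK : 6144 * (l : ℝ) ^ 2 * m ≤ k * K := by
    calc 6144 * (l : ℝ) ^ 2 * m ≤ k * α := (div_le_iff₀ hα0).1 (Nat.le_ceil _)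
      _ ≤ k * K := by gcongr; linarith
  have hk1 : (k : ℝ) ≤ 6144 * (2 * L) ^ 2 * m / α + 1 :=
    (Nat.ceil_lt_add_one (by positivity)).le.trans (by gcongr)
  obtain ⟨N, hN⟩ := exists_seminorm_pow_eq_sum (Fin n → ZMod 3) m hm
  obtain ⟨X, hXcard, hX⟩ := exists_almost_periods A hA m k l hm hl1 K hK0 hpK hkK N hN
  rw [hcardG] at hXcard
  have hX0 : (0 : ℝ) < X.card := by
    have h1 : (0 : ℝ) < (A.card : ℝ) ^ k * 3 ^ n := by positivity
    exact pos_of_mul_pos_right (h1.trans_le hXcard) (by positivity)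
  have hXne : X.Nonempty := Finset.card_pos.1 (Nat.cast_pos.1 hX0)
  have hinv (f : (Fin n → ZMod 3) → ℝ) (t) : N (fun x => f (x - t)) = N f := by
    refine (pow_left_inj₀ (apply_nonneg N _) (apply_nonneg N _) (by omega : 2 * m ≠ 0)).1 ?_
    rw [hN, hN]
    exact Equiv.sum_comp (Equiv.subRight t) fun x => f x ^ (2 * m)
  have hclose := seminorm_diffAvg_iterate_sub_le N hinv X hXne p _ hX l
  rw [show (l : ℝ) * (N p / (4 * l)) = N p / 4 by field_simp] at hclose
  obtain ⟨x₀, hx₀⟩ := exists_three_quarters_le N m hm hN p _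
    (diffAvg_iterate_nonneg X (conv_nind_ind_nonneg A) l) K hpK hclose
  obtain ⟨V, hVdim, hV⟩ := exists_submodule_annihilating_spectrum X hXne
  have hlogX : Real.log (Fintype.card (Fin n → ZMod 3) / X.card) ≤ Real.log 2 + k * L := by
    rw [hL, ← Real.log_pow, ← Real.log_mul (by norm_num) (by positivity), hcardG]
    refine Real.log_le_log (by positivity) ?_
    rw [hα, one_div_div, div_pow, ← mul_div_assoc, div_le_div_iff₀ hX0 (by positivity)]
    linarith
  refine ⟨V, hVdim.trans ((mul_le_mul_of_nonneg_left hlogX (by norm_num)).trans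
    (codim_bound hα0 (by linarith) hL1 (by exact_mod_cast hm) hk1)), ?_⟩
  have hpow : (1 / 4 : ℝ) ^ l ≤ α := by
    have h1 : (1 / 4 : ℝ) ≤ Real.exp (-1) := by
      rw [Real.exp_neg, ← one_div]
      exact one_div_le_one_div_of_le (Real.exp_pos _) (by linarith [Real.exp_one_lt_d9])
    calc (1 / 4 : ℝ) ^ l ≤ Real.exp (-1) ^ l := by gcongr
      _ = Real.exp (-l) := by rw [← Real.exp_nat_mul]; ring_nf
      _ ≤ Real.exp (-L) := by gcongr
      _ = α := by rw [hL, one_div, Real.log_inv, neg_neg, Real.exp_log hα0]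
  obtain ⟨x₁, hx₁⟩ := Finite.exists_max fun x => ∑ u : V, ind A (x + u)
  have hlow : Nat.card V * (5 * α) ≤ ∑ u : V, (diffAvg X)^[l] p (x₀ + u) := by
    rw [Nat.card_eq_fintype_card, ← nsmul_eq_mul, ← Finset.card_univ]
    refine Finset.card_nsmul_le_sum _ _ _ fun u _ => ?_
    have := (abs_le.1 (abs_diffAvg_iterate_sub_le A hA X l u (hV u u.2) x₀)).1
    rw [← hp] at this
    linarith
  have hup := hlow.trans (sum_diffAvg_iterate_le X hXne (fun u : V => (u : Fin n → ZMod 3))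
    (sum_conv_le A hA _ hx₁) l x₀)
  have hcount : ∑ u : V, ind A (x₁ + u) = ((A.filter fun a => a - x₁ ∈ V).card : ℝ) := by
    refine Eq.trans ?_ ((Finset.sum_boole (R := ℝ)
      (fun u : V => x₁ + (u : Fin n → ZMod 3) ∈ A) Finset.univ).trans ?_)
    · refine Finset.sum_congr rfl fun u _ => ?_
      unfold ind
      congr
    rw [Nat.cast_inj]
    refine Finset.card_bij (fun u _ => x₁ + (u : Fin n → ZMod 3)) ?_ ?_ ?_
    · intro u hu
      have hu' : x₁ + (u : Fin n → ZMod 3) ∈ A := (Finset.mem_filter.1 hu).2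
      exact Finset.mem_filter.2 ⟨hu', by simp⟩
    · intro u _ v _ huv
      exact Subtype.ext (add_left_cancel huv)
    · intro a ha
      obtain ⟨haA, haV⟩ := Finset.mem_filter.1 ha
      refine ⟨⟨a - x₁, haV⟩, Finset.mem_filter.2 ⟨Finset.mem_univ _, ?_⟩, ?_⟩ <;> simp [haA]
  refine ⟨x₁, ?_⟩
  rw [ge_iff_le, le_div_iff₀ (Nat.cast_pos.2 Nat.card_pos), ← hcount, mul_comm]
  exact hup
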